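/- Let H ∈ (1/2, 1) and α_H = H(2H−1), let μ be a measure on ℝ^d and ρ : ℝ^d → [0,∞) measurable. Then the following are equivalent: (i) ∫_{ℝ^d} (1/(1 + ρ(ξ)))^{2H} μ(dξ) < ∞; (ii) for every α > 0, α_H ∫_{ℝ^d} ∫₀^∞ ∫₀^∞ |r−s|^{2H−2} e^{−(α+ρ(ξ))(r+s)} dr ds μ(dξ) < ∞. -/

import Mathlib

open MeasureTheory

/-- The Gamma integral as a Lebesgue integral in `ℝ≥0∞`. -/
lemma lintegral_rpow_mul_exp_neg_mul_Ioi {a β : ℝ} (ha : 0 < a) (hβ : 0 < β) :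
    ∫⁻ u in Set.Ioi (0:ℝ), ENNReal.ofReal (u ^ (a - 1) * Real.exp (-(β * u))) =
      ENNReal.ofReal ((1 / β) ^ a * Real.Gamma a) := by
  have key := Real.integral_rpow_mul_exp_neg_mul_Ioi ha hβ
  have hpos : 0 < (1 / β) ^ a * Real.Gamma a :=
    mul_pos (Real.rpow_pos_of_pos (by positivity) _) (Real.Gamma_pos_of_pos ha)
  rw [← key, ofReal_integral_eq_lintegral_ofReal]
  · by_contra h
    rw [integral_undef h] at key
    exact hpos.ne key
  · refine (ae_restrict_iff' measurableSet_Ioi).2 (Filter.Eventually.of_forall fun u hu => ?_)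
    exact mul_nonneg (Real.rpow_nonneg (le_of_lt hu) _) (Real.exp_pos _).le

/-- The kernel `|r - s| ^ (a - 1) * exp (-β (r + s))` integrates to `β ^ (-(a + 1)) * Γ(a)` over the
positive quadrant. -/
lemma lintegral_lintegral_abs_sub_rpow_mul_exp {a β : ℝ} (ha : 0 < a) (ha1 : a ≠ 1)
    (hβ : 0 < β) :
    ∫⁻ r in Set.Ioi (0:ℝ), ∫⁻ s in Set.Ioi (0:ℝ),
        ENNReal.ofReal (|r - s| ^ (a - 1) * Real.exp (-(β * (r + s)))) =
      ENNReal.ofReal ((1 / β) ^ (a + 1)) * ENNReal.ofReal (Real.Gamma a) := by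
  set k : ℝ → ENNReal := (Set.Ioi (0:ℝ)).indicator
    fun u => ENNReal.ofReal (u ^ (a - 1) * Real.exp (-(β * u))) with hk
  have hkm : Measurable k := Measurable.indicator (by fun_prop) measurableSet_Ioi
  have hk0 : ∀ u, u ≤ 0 → k u = 0 := fun u hu =>
    Set.indicator_of_notMem (by simpa using hu) _
  have hk1 : ∀ u, 0 < u → k u = ENNReal.ofReal (u ^ (a - 1) * Real.exp (-(β * u))) :=
    fun u hu => Set.indicator_of_mem (Set.mem_Ioi.2 hu) _
  set G : ℝ → ℝ → ENNReal := fun r s => ENNReal.ofReal (Real.exp (-(2 * β * r))) * k (s - r)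
    with hG
  have hGm : Measurable (Function.uncurry G) := by
    simp only [hG, Function.uncurry_def]
    fun_prop
  have hlt : ∀ r s, r < s →
      ENNReal.ofReal (|r - s| ^ (a - 1) * Real.exp (-(β * (r + s)))) = G r s + G s r := by
    intro r s h
    simp only [hG]
    rw [hk0 (r - s) (by linarith), hk1 (s - r) (by linarith), mul_zero, add_zero,
      ← ENNReal.ofReal_mul (Real.exp_pos _).le, abs_sub_comm, abs_of_pos (sub_pos.2 h),
      mul_left_comm, ← Real.exp_add]
    ring_nf
  have hsplit : ∀ r s,
      ENNReal.ofReal (|r - s| ^ (a - 1) * Real.exp (-(β * (r + s)))) = G r s + G s r := by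
    intro r s
    rcases lt_trichotomy r s with h | h | h
    · exact hlt r s h
    · subst h
      simp [hG, hk0, Real.zero_rpow (sub_ne_zero.2 ha1)]
    · rw [abs_sub_comm, add_comm r s, hlt s r h, add_comm]
  have hin : ∀ r ∈ Set.Ioi (0:ℝ), ∫⁻ s in Set.Ioi (0:ℝ), G r s =
      ENNReal.ofReal (Real.exp (-(2 * β * r))) *
        ENNReal.ofReal ((1 / β) ^ a * Real.Gamma a) := by
    intro r hr
    have hsupp : Function.support (G r) ⊆ Set.Ioi (0:ℝ) := by
      intro s hs
      by_contra h
      refine hs ?_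
      have hr' : 0 < r := hr
      have hs' : s ≤ 0 := by simpa using h
      simp only [hG]
      rw [hk0 _ (by linarith), mul_zero]
    rw [setLIntegral_eq_of_support_subset hsupp]
    simp only [hG]
    rw [lintegral_const_mul _ (by fun_prop), lintegral_sub_right_eq_self k r, hk,
      lintegral_indicator measurableSet_Ioi, lintegral_rpow_mul_exp_neg_mul_Ioi ha hβ]
  have hexp : ∫⁻ r in Set.Ioi (0:ℝ), ENNReal.ofReal (Real.exp (-(2 * β * r))) =
      ENNReal.ofReal (1 / (2 * β)) := by
    simpa using lintegral_rpow_mul_exp_neg_mul_Ioi one_pos (mul_pos two_pos hβ)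
  have hJ : ∫⁻ r in Set.Ioi (0:ℝ), ∫⁻ s in Set.Ioi (0:ℝ), G r s =
      ENNReal.ofReal (1 / (2 * β)) * ENNReal.ofReal ((1 / β) ^ a * Real.Gamma a) := by
    rw [setLIntegral_congr_fun measurableSet_Ioi hin, lintegral_mul_const _ (by fun_prop), hexp]
  have hswap : ∫⁻ r in Set.Ioi (0:ℝ), ∫⁻ s in Set.Ioi (0:ℝ), G s r =
      ∫⁻ r in Set.Ioi (0:ℝ), ∫⁻ s in Set.Ioi (0:ℝ), G r s :=
    (lintegral_lintegral_swap hGm.aemeasurable).symm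
  have hΓ := (Real.Gamma_pos_of_pos ha).le
  have hGl : ∀ r, Measurable (G r) := fun r => hGm.comp measurable_prodMk_left
  simp_rw [hsplit, lintegral_add_left (hGl _)]
  have hGr : Measurable fun r => ∫⁻ s in Set.Ioi (0:ℝ), G r s := hGm.lintegral_prod_right'
  rw [lintegral_add_left hGr, hswap, hJ,
    ← ENNReal.ofReal_mul (by positivity), ← ENNReal.ofReal_add (by positivity) (by positivity),
    ← ENNReal.ofReal_mul (by positivity), Real.rpow_add (by positivity), Real.rpow_one]
  congr 1
  field_simp
  ring

lemma one_div_add_le_max_mul_one_div_one_add {α x : ℝ} (hα : 0 < α) (hx : 0 ≤ x) :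
    1 / (α + x) ≤ max 1 (1 / α) * (1 / (1 + x)) := by
  have h1 : (1:ℝ) ≤ max 1 (1 / α) := le_max_left _ _
  have h2 : 1 ≤ max 1 (1 / α) * α := by
    rw [← div_le_iff₀ hα]
    exact le_max_right _ _
  rw [mul_one_div, div_le_div_iff₀ (by positivity) (by positivity)]
  nlinarith

/-- Analytic content of Corollary 3.11: for `H ∈ (1/2,1)`, `α_H = H(2H-1)`, a measure `μ`
on `ℝ^d` and a measurable `ρ : ℝ^d → [0,∞)`, the following are equivalent:
(i) `∫ (1/(1+ρ(ξ)))^{2H} μ(dξ) < ∞`;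
(ii) for every `α > 0`, `α_H ∫∫₀^∞∫₀^∞ |r-s|^{2H-2} e^{-(α+ρ(ξ))(r+s)} dr ds μ(dξ) < ∞`. -/
theorem parabolic_condition_iff_resolvent_condition {d : ℕ}
    (H : ℝ) (hH : 1/2 < H) (hH1 : H < 1)
    (μ : Measure (EuclideanSpace ℝ (Fin d)))
    (ρ : EuclideanSpace ℝ (Fin d) → ℝ) (hρm : Measurable ρ) (hρ0 : ∀ ξ, 0 ≤ ρ ξ) :
    (∫⁻ ξ, ENNReal.ofReal ((1 / (1 + ρ ξ)) ^ (2*H)) ∂μ < ⊤) ↔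
      (∀ α : ℝ, 0 < α →
        ENNReal.ofReal (H * (2*H - 1)) *
          ∫⁻ ξ, (∫⁻ r in Set.Ioi (0:ℝ), ∫⁻ s in Set.Ioi (0:ℝ),
            ENNReal.ofReal
              (|r - s| ^ (2*H - 2) * Real.exp (-((α + ρ ξ) * (r + s))))) ∂μ < ⊤) := by
  have hform : ∀ α : ℝ, 0 < α → ∀ ξ,
      (∫⁻ r in Set.Ioi (0:ℝ), ∫⁻ s in Set.Ioi (0:ℝ), ENNReal.ofReal
        (|r - s| ^ (2*H - 2) * Real.exp (-((α + ρ ξ) * (r + s))))) =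
      ENNReal.ofReal ((1 / (α + ρ ξ)) ^ (2*H)) * ENNReal.ofReal (Real.Gamma (2*H - 1)) := by
    intro α hα ξ
    have h := lintegral_lintegral_abs_sub_rpow_mul_exp (a := 2*H - 1) (β := α + ρ ξ)
      (by linarith) (by linarith) (by linarith [hρ0 ξ])
    rwa [show 2*H - 1 - 1 = 2*H - 2 by ring, show 2*H - 1 + 1 = 2*H by ring] at h
  have hm : ∀ α : ℝ, Measurable fun ξ => ENNReal.ofReal ((1 / (α + ρ ξ)) ^ (2*H)) := by
    intro α
    fun_prop
  have hfin : ∀ α : ℝ, 0 < α → (ENNReal.ofReal (H * (2*H - 1)) *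
      ∫⁻ ξ, (∫⁻ r in Set.Ioi (0:ℝ), ∫⁻ s in Set.Ioi (0:ℝ), ENNReal.ofReal
        (|r - s| ^ (2*H - 2) * Real.exp (-((α + ρ ξ) * (r + s))))) ∂μ < ⊤ ↔
      ∫⁻ ξ, ENNReal.ofReal ((1 / (α + ρ ξ)) ^ (2*H)) ∂μ < ⊤) := by
    intro α hα
    have hc : ENNReal.ofReal (H * (2*H - 1)) ≠ 0 :=
      (ENNReal.ofReal_pos.2 (mul_pos (by linarith) (by linarith))).ne'
    have hg : ENNReal.ofReal (Real.Gamma (2*H - 1)) ≠ 0 :=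
      (ENNReal.ofReal_pos.2 (Real.Gamma_pos_of_pos (by linarith))).ne'
    simp_rw [hform α hα]
    rw [lintegral_mul_const _ (hm α)]
    simp only [lt_top_iff_ne_top, ne_eq, ENNReal.mul_eq_top, hc, hg, ENNReal.ofReal_ne_top,
      not_false_eq_true, true_and, false_and, and_false, and_true, false_or, or_false]
  constructor
  · intro h α hα
    rw [hfin α hα]
    calc ∫⁻ ξ, ENNReal.ofReal ((1 / (α + ρ ξ)) ^ (2*H)) ∂μ
        ≤ ∫⁻ ξ, ENNReal.ofReal (max 1 (1 / α) ^ (2*H)) *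
            ENNReal.ofReal ((1 / (1 + ρ ξ)) ^ (2*H)) ∂μ := by
          refine lintegral_mono fun ξ => ?_
          have hξ := hρ0 ξ
          rw [← ENNReal.ofReal_mul (by positivity),
            ← Real.mul_rpow (by positivity) (by positivity)]
          exact ENNReal.ofReal_le_ofReal (Real.rpow_le_rpow (by positivity)
            (one_div_add_le_max_mul_one_div_one_add hα hξ) (by linarith))
      _ = ENNReal.ofReal (max 1 (1 / α) ^ (2*H)) *
            ∫⁻ ξ, ENNReal.ofReal ((1 / (1 + ρ ξ)) ^ (2*H)) ∂μ := lintegral_const_mul _ (hm 1)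
      _ < ⊤ := ENNReal.mul_lt_top ENNReal.ofReal_lt_top h
  · intro h
    exact (hfin 1 one_pos).1 (h 1 one_pos)
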